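/- Let χ be a symmetric nondegenerate bilinear form on (ℤ/2ℤ)ⁿ with values in {±1} such that χ(a,a) = 1 for all a. Then n is even and ((ℤ/2ℤ)ⁿ, χ) is isomorphic to the (n/2)-fold orthogonal sum of the standard hyperbolic pairing on (ℤ/2ℤ)². -/

import Mathlib

/-- The Klein four-group. -/
abbrev K4 : Type := ZMod 2 × ZMod 2

/-- The standard hyperbolic pairing on `K₄`. -/
noncomputable def hq (a b : K4) : ℝˣ :=
  (-1 : ℝˣ) ^ (a.1 * b.2 + a.2 * b.1 : ZMod 2).val

theorem aux_symp (k : ℕ) : ∀ (V : Type) [AddCommGroup V] [Module (ZMod 2) V] [Finite V]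
    (B : V →ₗ[ZMod 2] V →ₗ[ZMod 2] ZMod 2),
    Nat.card V ≤ k → (∀ a b, B a b = B b a) → (∀ a, B a a = 0) →
    (∀ a, (∀ b, B a b = 0) → a = 0) →
    ∃ m : ℕ, ∃ f : V ≃ₗ[ZMod 2] (Fin m → K4),
      ∀ a b, B a b = ∑ i, ((f a i).1 * (f b i).2 + (f a i).2 * (f b i).1) := by
  induction k with
  | zero =>
    intro V _ _ _ B hk
    have := Nat.card_pos (α := V)
    omega
  | succ k ih =>
    intro V _ _ _ B hk hsym halt hnd
    rcases subsingleton_or_nontrivial V with hV | hV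
    · refine ⟨0, LinearEquiv.ofSubsingleton _ _, fun a b => ?_⟩
      rw [Subsingleton.elim a 0]; simp
    obtain ⟨x, hx⟩ := exists_ne (0 : V)
    obtain ⟨y, hy⟩ : ∃ y, B x y = 1 := by
      by_contra! h
      apply hx
      apply hnd
      intro b
      have h2 := h b
      revert h2
      generalize B x b = t
      revert t
      decide
    have hyx : B y x = 1 := by rw [hsym, hy]
    let W : Submodule (ZMod 2) V := LinearMap.ker (B x) ⊓ LinearMap.ker (B y)
    have hW : ∀ w : V, w ∈ W ↔ B x w = 0 ∧ B y w = 0 := by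
      intro w; simp [W]
    have hW1 : ∀ w : W, B x w = 0 := fun w => ((hW _).1 w.2).1
    have hW2 : ∀ w : W, B y w = 0 := fun w => ((hW _).1 w.2).2
    have hW3 : ∀ w : W, B w x = 0 := fun w => by rw [hsym, hW1]
    have hW4 : ∀ w : W, B w y = 0 := fun w => by rw [hsym, hW2]
    let g : (K4 × W) →ₗ[ZMod 2] V :=
      { toFun := fun p => p.1.1 • x + p.1.2 • y + (p.2 : V)
        map_add' := by intro p q; simp; module
        map_smul' := by intro c p; simp; module }
    have hg : ∀ p : K4 × W, g p = p.1.1 • x + p.1.2 • y + (p.2 : V) := fun _ => rfl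
    have hgB : ∀ p q : K4 × W,
        B (g p) (g q) = p.1.1 * q.1.2 + p.1.2 * q.1.1 + B p.2 q.2 := by
      intro p q
      simp [hg, halt, hy, hyx, hW1, hW2, hW3, hW4]
      try ring
    have hinj : Function.Injective g := by
      rw [injective_iff_map_eq_zero]
      intro p hp
      have h1 : B x (g p) = p.1.2 := by simp [hg, halt, hy, hW1]
      have h2 : B y (g p) = p.1.1 := by simp [hg, halt, hyx, hW2]
      rw [hp, map_zero] at h1 h2
      rw [hg, ← h1, ← h2] at hp
      ext
      · simp [← h2]
      · simp [← h1]
      · simpa using hp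
    have hsurj : Function.Surjective g := by
      intro v
      refine ⟨((B y v, B x v), ⟨v - B y v • x - B x v • y, ?_⟩), ?_⟩
      · rw [hW]; simp [halt, hy, hyx]
      · rw [hg]; simp
    let e : (K4 × W) ≃ₗ[ZMod 2] V := LinearEquiv.ofBijective g ⟨hinj, hsurj⟩
    have hcard : Nat.card W ≤ k := by
      have : Nat.card W < Nat.card V := by
        apply Finite.card_subtype_lt (x := y)
        intro h
        have := ((hW y).1 h).1
        rw [hy] at this
        exact absurd this (by decide)
      omega
    obtain ⟨m, f, hf⟩ := ih W ((B.domRestrict₁₂ W W)) hcard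
      (fun a b => hsym _ _) (fun a => halt _) (by
        intro a ha
        have : (a : V) = 0 := by
          apply hnd
          intro b
          obtain ⟨q, rfl⟩ := hsurj b
          have h0 : (a : V) = g (0, a) := by simp [hg]
          rw [h0, hgB]
          have h1 : B (a : V) (q.2 : V) = 0 := ha q.2
          simpa using h1
        exact_mod_cast this)
    let F : V ≃ₗ[ZMod 2] (Fin (m+1) → K4) :=
      e.symm ≪≫ₗ ((LinearEquiv.refl (ZMod 2) K4).prodCongr f) ≪≫ₗ
        Fin.consLinearEquiv (ZMod 2) (fun _ : Fin (m+1) => K4)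
    have hF0 : ∀ p, F (g p) 0 = p.1 := by
      intro p
      have : e.symm (g p) = p := e.symm_apply_apply p
      simp [F, this]
    have hFs : ∀ p (i : Fin m), F (g p) i.succ = f p.2 i := by
      intro p i
      have : e.symm (g p) = p := e.symm_apply_apply p
      simp [F, this]
    refine ⟨m + 1, F, fun a b => ?_⟩
    obtain ⟨p, rfl⟩ := hsurj a
    obtain ⟨q, rfl⟩ := hsurj b
    rw [hgB, Fin.sum_univ_succ]
    simp only [hF0, hFs]
    rw [← hf]
    rfl

theorem aux_pow_add (a b : ZMod 2) :
    (-1 : ℝˣ) ^ (a + b).val = (-1 : ℝˣ) ^ a.val * (-1 : ℝˣ) ^ b.val := by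
  have e0 : (0 : ZMod 2).val = 0 := rfl
  have e1 : (1 : ZMod 2).val = 1 := rfl
  have e2 : (1 + 1 : ZMod 2) = 0 := rfl
  rcases (by decide : ∀ a : ZMod 2, a = 0 ∨ a = 1) a with rfl | rfl <;>
  rcases (by decide : ∀ a : ZMod 2, a = 0 ∨ a = 1) b with rfl | rfl <;>
  simp [e0, e1, e2]

theorem aux_pow_sum {ι : Type} (s : Finset ι) (t : ι → ZMod 2) :
    (-1 : ℝˣ) ^ (∑ i ∈ s, t i).val = ∏ i ∈ s, (-1 : ℝˣ) ^ (t i).val := by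
  classical
  induction s using Finset.induction_on with
  | empty => simp
  | insert i s hi ih => rw [Finset.sum_insert hi, Finset.prod_insert hi, aux_pow_add, ih]

theorem aux_ne : (-1 : ℝˣ) ≠ 1 := by
  intro h
  have := congrArg Units.val h
  norm_num at this

theorem aux_inj (a b : ZMod 2) (h : (-1 : ℝˣ) ^ a.val = (-1 : ℝˣ) ^ b.val) : a = b := by
  have h1 := aux_ne
  have h2 := aux_ne.symm
  have e0 : (0 : ZMod 2).val = 0 := rfl
  have e1 : (1 : ZMod 2).val = 1 := rfl
  rcases (by decide : ∀ a : ZMod 2, a = 0 ∨ a = 1) a with rfl | rfl <;>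
  rcases (by decide : ∀ a : ZMod 2, a = 0 ∨ a = 1) b with rfl | rfl <;>
  simp_all

/-- Wall's classification: a symmetric nondegenerate `{±1}`-valued bilinear
form `χ` on `(ℤ/2ℤ)ⁿ` with `χ(a,a) = 1` for all `a` is isomorphic to a power of
the standard hyperbolic pairing; in particular `n` is even. -/
theorem stmt12 (n : ℕ) (χ : (Fin n → ZMod 2) → (Fin n → ZMod 2) → ℝˣ)
    (hl : ∀ a b c, χ (a + b) c = χ a c * χ b c)
    (hr : ∀ a b c, χ a (b + c) = χ a b * χ a c)
    (hsym : ∀ a b, χ a b = χ b a)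
    (hval : ∀ a b, χ a b = 1 ∨ χ a b = -1)
    (hnd : ∀ a, (∀ b, χ a b = 1) → a = 0)
    (halt : ∀ a, χ a a = 1) :
    ∃ m : ℕ, n = 2 * m ∧
      ∃ f : (Fin n → ZMod 2) ≃+ (Fin m → K4),
        ∀ a b, χ a b = ∏ i, hq (f a i) (f b i) := by
  have hex : ∀ a b, ∃ t : ZMod 2, χ a b = (-1 : ℝˣ) ^ t.val := by
    intro a b
    rcases hval a b with h | h
    · exact ⟨0, by simp [h]⟩
    · exact ⟨1, by rw [h, ZMod.val_one, pow_one]⟩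
  choose β hβ using hex
  have hβl : ∀ a b c, β (a + b) c = β a c + β b c := fun a b c =>
    aux_inj _ _ (by rw [aux_pow_add, ← hβ, ← hβ, ← hβ, hl])
  have hβr : ∀ a b c, β a (b + c) = β a b + β a c := fun a b c =>
    aux_inj _ _ (by rw [aux_pow_add, ← hβ, ← hβ, ← hβ, hr])
  let B : (Fin n → ZMod 2) →ₗ[ZMod 2] (Fin n → ZMod 2) →ₗ[ZMod 2] ZMod 2 :=
    AddMonoidHom.toZModLinearMap 2 (AddMonoidHom.mk'
      (fun a => AddMonoidHom.toZModLinearMap 2 (AddMonoidHom.mk' (β a) (hβr a)))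
      (fun a b => LinearMap.ext fun c => hβl a b c))
  have hB : ∀ a b, B a b = β a b := fun _ _ => rfl
  obtain ⟨m, f, hf⟩ := aux_symp _ (Fin n → ZMod 2) B le_rfl
    (fun a b => aux_inj _ _ (by rw [hB, hB, ← hβ, ← hβ, hsym]))
    (fun a => aux_inj _ _ (by rw [hB, ← hβ, halt]; simp))
    (fun a h => hnd a fun b => by rw [hβ, ← hB, h]; simp)
  refine ⟨m, ?_, f.toAddEquiv, fun a b => ?_⟩
  · have := f.finrank_eq
    simp [Module.finrank_pi_fintype] at this
    omega
  · rw [hβ, ← hB, hf, aux_pow_sum]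
    rfl
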